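/- Fix an integer d ≥ 3, let L_d = {0, 1/(d−1), …, 1}, fix λ ∈ L_d with 0 < λ < 1, and let f²_{d,λ} : L_d^3 → L_d^3 be defined by the first applicable of the following rules: i) (x₂,x₁,x₃) if x₁ = 0, 0 < x₂ < 1 and x₃ = λ; ii) (x₂,x₁,x₃) if 0 < x₁ < 1, x₂ = 0 and x₃ = λ; iii) (x₁,x₃,x₂) if x₁ = 0, x₂ ≠ λ, x₃ ≠ λ and x₂ ≠ x₃; iv) (x₁,x₃,x₂) if 0 ≤ x₁ ≤ x₃ < 1 and x₂ = 1; v) (x₁,x₃,x₂) if 0 ≤ x₁ ≤ x₂ < 1 and x₃ = 1; vi) (x₁,x₁,1−x₁+x₃) if x₃ < x₁ < 1 and x₂ = 1; vii) (x₁,1,x₃+x₁−1) if x₁ < 1, x₂ = x₁, x₃+x₁ ≥ 1 and x₃ < 1; viii) (x₁,x₁,x₂−x₁) if 0 ≤ x₁ < x₂ < 1 and x₃ = 0; ix) (x₁,x₃+x₁,0) if 0 ≤ x₁, x₂ = x₁, x₃+x₁ < 1 and x₃ > 0; x) (x₁,x₂,x₃) otherwise. Then f²_{d,λ} is self-reversible: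 f²_{d,λ}(f²_{d,λ}(x)) = x for every x ∈ L_d^3 (in particular, f²_{d,λ} is a bijection of L_d^3). -/

import Mathlib

/-- The set of truth values `L_d = {0, 1/(d-1), …, 1}` as a finite set of reals. -/
noncomputable def Ld (d : ℕ) : Finset ℝ :=
  (Finset.range d).image (fun k : ℕ => (k : ℝ) / ((d : ℝ) - 1))

/-- The gate `f²_{d,λ}`, defined by the first applicable of rules i) – x). -/
noncomputable def f2 (lam : ℝ) (x : ℝ × ℝ × ℝ) : ℝ × ℝ × ℝ :=
  let x₁ := x.1; let x₂ := x.2.1; let x₃ := x.2.2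
  if x₁ = 0 ∧ 0 < x₂ ∧ x₂ < 1 ∧ x₃ = lam then (x₂, x₁, x₃)                   -- i)
  else if 0 < x₁ ∧ x₁ < 1 ∧ x₂ = 0 ∧ x₃ = lam then (x₂, x₁, x₃)              -- ii)
  else if x₁ = 0 ∧ x₂ ≠ lam ∧ x₃ ≠ lam ∧ x₂ ≠ x₃ then (x₁, x₃, x₂)           -- iii)
  else if 0 ≤ x₁ ∧ x₁ ≤ x₃ ∧ x₃ < 1 ∧ x₂ = 1 then (x₁, x₃, x₂)               -- iv)
  else if 0 ≤ x₁ ∧ x₁ ≤ x₂ ∧ x₂ < 1 ∧ x₃ = 1 then (x₁, x₃, x₂)               -- v)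
  else if x₃ < x₁ ∧ x₁ < 1 ∧ x₂ = 1 then (x₁, x₁, 1 - x₁ + x₃)               -- vi)
  else if x₁ < 1 ∧ x₂ = x₁ ∧ 1 ≤ x₃ + x₁ ∧ x₃ < 1 then (x₁, 1, x₃ + x₁ - 1)  -- vii)
  else if 0 ≤ x₁ ∧ x₁ < x₂ ∧ x₂ < 1 ∧ x₃ = 0 then (x₁, x₁, x₂ - x₁)          -- viii)
  else if 0 ≤ x₁ ∧ x₂ = x₁ ∧ x₃ + x₁ < 1 ∧ 0 < x₃ then (x₁, x₃ + x₁, 0)      -- ix)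
  else (x₁, x₂, x₃)                                                           -- x)

theorem f2_f2_of_mem_Icc {lam a b c : ℝ} (hlam0 : 0 < lam) (hlam1 : lam < 1)
    (ha : a ∈ Set.Icc (0 : ℝ) 1) (hb : b ∈ Set.Icc (0 : ℝ) 1) (hc : c ∈ Set.Icc (0 : ℝ) 1) :
    f2 lam (f2 lam (a, b, c)) = (a, b, c) := by
  obtain ⟨ha0, ha1⟩ := ha
  obtain ⟨hb0, hb1⟩ := hb
  obtain ⟨hc0, hc1⟩ := hc
  conv_lhs => arg 2; simp only [f2]
  split_ifs <;> simp only [f2] <;> grind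

theorem mem_Icc_of_mem_Ld {d : ℕ} (hd : 2 ≤ d) {x : ℝ} (hx : x ∈ Ld d) :
    x ∈ Set.Icc (0 : ℝ) 1 := by
  obtain ⟨k, hk, rfl⟩ := Finset.mem_image.mp hx
  have hd' : (2 : ℝ) ≤ d := by exact_mod_cast hd
  have hk' : (k : ℝ) + 1 ≤ d := by exact_mod_cast Finset.mem_range.mp hk
  exact ⟨div_nonneg k.cast_nonneg (by linarith), (div_le_one (by linarith)).mpr (by linarith)⟩

theorem mem_Ld_iff {d : ℕ} (hd : 2 ≤ d) {x : ℝ} :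
    x ∈ Ld d ↔ x ∈ Set.Icc (0 : ℝ) 1 ∧ ∃ z : ℤ, x * ((d : ℝ) - 1) = z := by
  have hd' : (0 : ℝ) < d - 1 := by
    have : (2 : ℝ) ≤ d := by exact_mod_cast hd
    linarith
  refine ⟨fun hx => ⟨mem_Icc_of_mem_Ld hd hx, ?_⟩, ?_⟩
  · obtain ⟨k, -, rfl⟩ := Finset.mem_image.mp hx
    exact ⟨k, by push_cast; field_simp⟩
  · rintro ⟨⟨h0, h1⟩, z, hz⟩
    have hz0 : 0 ≤ z := by
      have : (0 : ℝ) ≤ z := hz ▸ mul_nonneg h0 hd'.le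
      exact_mod_cast this
    lift z to ℕ using hz0
    rw [Int.cast_natCast] at hz
    refine Finset.mem_image.mpr ⟨z, Finset.mem_range.mpr ?_, by rw [← hz]; field_simp⟩
    have : (z : ℝ) < d := by nlinarith
    exact_mod_cast this

theorem Ld_add_sub_mem {d : ℕ} (hd : 2 ≤ d) {x y z : ℝ} (hx : x ∈ Ld d) (hy : y ∈ Ld d)
    (hz : z ∈ Ld d) (h0 : 0 ≤ x + y - z) (h1 : x + y - z ≤ 1) : x + y - z ∈ Ld d := by
  obtain ⟨-, i, hi⟩ := (mem_Ld_iff hd).mp hx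
  obtain ⟨-, j, hj⟩ := (mem_Ld_iff hd).mp hy
  obtain ⟨-, k, hk⟩ := (mem_Ld_iff hd).mp hz
  exact (mem_Ld_iff hd).mpr ⟨⟨h0, h1⟩, i + j - k, by push_cast; linear_combination hi + hj - hk⟩

theorem f2_mem_Ld {d : ℕ} (hd : 2 ≤ d) {lam a b c : ℝ}
    (ha : a ∈ Ld d) (hb : b ∈ Ld d) (hc : c ∈ Ld d) :
    (f2 lam (a, b, c)).1 ∈ Ld d ∧ (f2 lam (a, b, c)).2.1 ∈ Ld d ∧
      (f2 lam (a, b, c)).2.2 ∈ Ld d := by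
  have h0 : (0 : ℝ) ∈ Ld d := (mem_Ld_iff hd).mpr ⟨by simp, 0, by simp⟩
  have h1 : (1 : ℝ) ∈ Ld d := (mem_Ld_iff hd).mpr ⟨by simp, d - 1, by simp⟩
  obtain ⟨ha0, ha1⟩ := mem_Icc_of_mem_Ld hd ha
  obtain ⟨hb0, hb1⟩ := mem_Icc_of_mem_Ld hd hb
  obtain ⟨hc0, hc1⟩ := mem_Icc_of_mem_Ld hd hc
  have vi := Ld_add_sub_mem hd h1 hc ha
  have vii := Ld_add_sub_mem hd hc ha h1
  have viii := Ld_add_sub_mem hd hb h0 ha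
  have ix := Ld_add_sub_mem hd hc ha h0
  simp only [f2]
  split_ifs <;> grind

theorem stmt_15 (d : ℕ) (hd : 3 ≤ d) (lam : ℝ) (hlam : lam ∈ Ld d)
    (hlam0 : 0 < lam) (hlam1 : lam < 1) :
    (∀ x : ℝ × ℝ × ℝ, x.1 ∈ Ld d → x.2.1 ∈ Ld d → x.2.2 ∈ Ld d →
      f2 lam (f2 lam x) = x) ∧
    Set.BijOn (f2 lam) {x : ℝ × ℝ × ℝ | x.1 ∈ Ld d ∧ x.2.1 ∈ Ld d ∧ x.2.2 ∈ Ld d}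
      {x : ℝ × ℝ × ℝ | x.1 ∈ Ld d ∧ x.2.1 ∈ Ld d ∧ x.2.2 ∈ Ld d} := by
  have hd2 : 2 ≤ d := by omega
  have hinv : ∀ x : ℝ × ℝ × ℝ, x.1 ∈ Ld d → x.2.1 ∈ Ld d → x.2.2 ∈ Ld d →
      f2 lam (f2 lam x) = x := fun x h₁ h₂ h₃ =>
    f2_f2_of_mem_Icc hlam0 hlam1 (mem_Icc_of_mem_Ld hd2 h₁) (mem_Icc_of_mem_Ld hd2 h₂)
      (mem_Icc_of_mem_Ld hd2 h₃)
  have hmaps : Set.MapsTo (f2 lam)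
      {x : ℝ × ℝ × ℝ | x.1 ∈ Ld d ∧ x.2.1 ∈ Ld d ∧ x.2.2 ∈ Ld d}
      {x : ℝ × ℝ × ℝ | x.1 ∈ Ld d ∧ x.2.1 ∈ Ld d ∧ x.2.2 ∈ Ld d} :=
    fun x hx => f2_mem_Ld hd2 hx.1 hx.2.1 hx.2.2
  have hleft : Set.LeftInvOn (f2 lam) (f2 lam)
      {x : ℝ × ℝ × ℝ | x.1 ∈ Ld d ∧ x.2.1 ∈ Ld d ∧ x.2.2 ∈ Ld d} :=
    fun x hx => hinv x hx.1 hx.2.1 hx.2.2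
  exact ⟨hinv, Set.InvOn.bijOn ⟨hleft, hleft⟩ hmaps hmaps⟩
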